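/- Let 𝔤 be a finite-dimensional real vector space with dim 𝔤 > 0 and let {·,·} be a strongly-affine Jacobi bracket on C^∞(𝔤,ℝ). Then there exist a unique Lie algebra bracket [·,·]_* on 𝔤*, a unique X₀ ∈ 𝔤 with [α,β]_*(X₀) = 0 for all α,β ∈ 𝔤*, and a unique antisymmetric bilinear form P₀ on 𝔤* satisfying P₀([α,β]_*,γ) + P₀([β,γ]_*,α) + P₀([γ,α]_*,β) = α(X₀)·P₀(β,γ) + β(X₀)·P₀(γ,α) + γ(X₀)·P₀(α,β), such that for all f,g ∈ C^∞(𝔤,ℝ) and x ∈ 𝔤: {f,g}(x) = [Df(x),Dg(x)]_*(x) + Df(x)(x)·Dg(x)(X₀) − Df(x)(X₀)·Dg(x)(x) − P₀(Df(x),Dg(x)) − f(x)·Dg(x)(X₀) + g(x)·Df(x)(X₀). (One-to-one correspondence between strongly-affine Jacobi structures on 𝔤 and Jacobi-algebroid data ([·,·]_*, X₀) together with P₀ with d_*P₀ = −X₀∧P₀.) -/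

import Mathlib

/-- A Jacobi bracket on the smooth functions (those satisfying the predicate `S`)
of a space `N`: an ℝ-bilinear antisymmetric bracket satisfying the Jacobi identity
and the generalized Leibniz rule. -/
structure JacobiBracket (N : Type*) (S : (N → ℝ) → Prop) where
  br : (N → ℝ) → (N → ℝ) → N → ℝ
  smooth_br : ∀ f g, S f → S g → S (br f g)
  add_left : ∀ f g h, S f → S g → S h → br (f + g) h = br f h + br g h
  smul_left : ∀ (c : ℝ) (f g : N → ℝ), S f → S g → br (c • f) g = c • br f g
  antisymm : ∀ f g, S f → S g → br f g = -br g f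
  jacobi : ∀ f g h, S f → S g → S h →
    br f (br g h) + br g (br h f) + br h (br f g) = 0
  leibniz : ∀ f g h, S f → S g → S h →
    br f (g * h) = br f g * h + g * br f h - g * h * br f 1

/-- Smooth (C^∞) real functions on a normed space `V`. -/
def Cinf (V : Type*) [NormedAddCommGroup V] [NormedSpace ℝ V] : (V → ℝ) → Prop :=
  fun f => ContDiff ℝ (⊤ : ℕ∞) f

/-- Affine real functions on a real vector space: `x ↦ μ(x) + c` with `μ` linear. -/
def IsAffineFn {V : Type*} [AddCommGroup V] [Module ℝ V] (f : V → ℝ) : Prop :=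
  ∃ (μ : V →ₗ[ℝ] ℝ) (c : ℝ), ∀ x, f x = μ x + c

/-- A Jacobi bracket on `C^∞(V,ℝ)` is affine if the bracket of two affine functions
is affine. -/
def IsAffineJacobi {V : Type*} [NormedAddCommGroup V] [NormedSpace ℝ V]
    (J : JacobiBracket V (Cinf V)) : Prop :=
  ∀ a b, Cinf V a → Cinf V b → IsAffineFn a → IsAffineFn b → IsAffineFn (J.br a b)

/-- The algebraic data on the dual of `𝔤` associated with a strongly-affine Jacobi
structure: a Lie algebra bracket `B = [·,·]_*` on `𝔤*`, a 1-cocycle `X₀ ∈ 𝔤`, and an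
antisymmetric bilinear form `P₀` on `𝔤*` with `d_*P₀ = −X₀∧P₀`. -/
def JacobiAlgebroidData (g : Type*) [NormedAddCommGroup g] [NormedSpace ℝ g]
    (B : (g →L[ℝ] ℝ) → (g →L[ℝ] ℝ) → (g →L[ℝ] ℝ)) (X₀ : g)
    (P₀ : (g →L[ℝ] ℝ) → (g →L[ℝ] ℝ) → ℝ) : Prop :=
  (∀ α β γ, B (α + β) γ = B α γ + B β γ) ∧
  (∀ (r : ℝ) (α β), B (r • α) β = r • B α β) ∧
  (∀ α β, B α β = -B β α) ∧
  (∀ α β γ, B α (B β γ) + B β (B γ α) + B γ (B α β) = 0) ∧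
  (∀ α β, B α β X₀ = 0) ∧
  (∀ α β γ, P₀ (α + β) γ = P₀ α γ + P₀ β γ) ∧
  (∀ (r : ℝ) (α β), P₀ (r • α) β = r * P₀ α β) ∧
  (∀ α β, P₀ α β = -P₀ β α) ∧
  (∀ α β γ, P₀ (B α β) γ + P₀ (B β γ) α + P₀ (B γ α) β
    = α X₀ * P₀ β γ + β X₀ * P₀ γ α + γ X₀ * P₀ α β)

/-- The bracket is given on smooth functions by the formula
`{f,g}(x) = [Df(x),Dg(x)]_*(x) + Df(x)(x)·Dg(x)(X₀) − Df(x)(X₀)·Dg(x)(x)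
 − P₀(Df(x),Dg(x)) − f(x)·Dg(x)(X₀) + g(x)·Df(x)(X₀)`. -/
def BrFormula (g : Type*) [NormedAddCommGroup g] [NormedSpace ℝ g]
    (J : JacobiBracket g (Cinf g))
    (B : (g →L[ℝ] ℝ) → (g →L[ℝ] ℝ) → (g →L[ℝ] ℝ)) (X₀ : g)
    (P₀ : (g →L[ℝ] ℝ) → (g →L[ℝ] ℝ) → ℝ) : Prop :=
  ∀ f g', Cinf g f → Cinf g g' → ∀ x,
    J.br f g' x = B (fderiv ℝ f x) (fderiv ℝ g' x) x
      + fderiv ℝ f x x * fderiv ℝ g' x X₀ - fderiv ℝ f x X₀ * fderiv ℝ g' x x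
      - P₀ (fderiv ℝ f x) (fderiv ℝ g' x)
      - f x * fderiv ℝ g' x X₀ + g' x * fderiv ℝ f x X₀

universe u

/-- An integral over a compact interval depending on a parameter is as smooth as its integrand. -/
theorem contDiff_parametric_intervalIntegral {V : Type u} [NormedAddCommGroup V] [NormedSpace ℝ V]
    [FiniteDimensional ℝ V] (n : ℕ) {E : Type u} [NormedAddCommGroup E] [NormedSpace ℝ E]
    (a b : ℝ) (F : V → ℝ → E) (hF : ContDiff ℝ n (Function.uncurry F)) :
    ContDiff ℝ n (fun y => ∫ t in a..b, F y t) := by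
  induction n generalizing E with
  | zero =>
    simp only [Nat.cast_zero, contDiff_zero] at hF ⊢
    exact intervalIntegral.continuous_parametric_intervalIntegral_of_continuous' hF a b
  | succ n ih =>
    have hcF : Continuous (Function.uncurry F) := hF.continuous
    push_cast at hF ⊢
    set F' : V → ℝ → V →L[ℝ] E := fun y t =>
      (fderiv ℝ (Function.uncurry F) (y, t)).comp (ContinuousLinearMap.inl ℝ V ℝ)
    have hsm : ContDiff ℝ n (Function.uncurry F') := by
      have h1 : ContDiff ℝ n (fderiv ℝ (Function.uncurry F)) := hF.fderiv_right le_rfl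
      exact h1.clm_comp contDiff_const
    have hcF' : Continuous (Function.uncurry F') := hsm.continuous
    have hder : ∀ y t, HasFDerivAt (fun y => F y t) (F' y t) y := by
      intro y t
      have h1 : HasFDerivAt (Function.uncurry F) (fderiv ℝ (Function.uncurry F) (y, t)) (y, t) :=
        ((hF.differentiable (by simp)) (y, t)).hasFDerivAt
      have h2 : HasFDerivAt (fun y : V => (y, t)) (ContinuousLinearMap.inl ℝ V ℝ) y :=
        hasFDerivAt_prodMk_left y t
      exact h1.comp y h2
    rw [contDiff_succ_iff_hasFDerivAt]
    refine ⟨fun y => ∫ t in a..b, F' y t, ih F' hsm, fun x => ?_⟩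
    obtain ⟨C, hC⟩ := ((isCompact_closedBall x 1).prod
      (isCompact_uIcc (a := a) (b := b))).exists_bound_of_continuousOn hcF'.continuousOn
    have hcont : ∀ y, Continuous (F y) := fun y => hcF.comp (by fun_prop : Continuous fun t => (y, t))
    have hcont' : Continuous (F' x) := hcF'.comp (by fun_prop : Continuous fun t => (x, t))
    refine intervalIntegral.hasFDerivAt_integral_of_dominated_of_fderiv_le
      (bound := fun _ => C) (Metric.closedBall_mem_nhds x one_pos)
      (Filter.Eventually.of_forall fun y => (hcont y).aestronglyMeasurable)
      ((hcont x).intervalIntegrable a b) hcont'.aestronglyMeasurable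
      (Filter.Eventually.of_forall fun t ht y hy => hC (y, t) ⟨hy, Set.uIoc_subset_uIcc ht⟩)
      intervalIntegrable_const
      (Filter.Eventually.of_forall fun t _ y _ => hder y t)

/-- **Hadamard's lemma**. -/
theorem exists_contDiff_eq_add_apply_sub {V : Type u} [NormedAddCommGroup V] [NormedSpace ℝ V]
    [FiniteDimensional ℝ V] {f : V → ℝ} (hf : ContDiff ℝ (⊤ : ℕ∞) f) (x : V) :
    ∃ H : V → V →L[ℝ] ℝ, ContDiff ℝ (⊤ : ℕ∞) H ∧ H x = fderiv ℝ f x ∧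
      ∀ y, f y = f x + H y (y - x) := by
  have hf' : ContDiff ℝ (⊤ : ℕ∞) (fderiv ℝ f) := hf.fderiv_right (by simp)
  have hpath : ContDiff ℝ (⊤ : ℕ∞) (fun p : V × ℝ => x + p.2 • (p.1 - x)) := by fun_prop
  have hsm : ContDiff ℝ (⊤ : ℕ∞)
      (Function.uncurry fun (y : V) (t : ℝ) => fderiv ℝ f (x + t • (y - x))) := hf'.comp hpath
  refine ⟨fun y => ∫ t in (0 : ℝ)..1, fderiv ℝ f (x + t • (y - x)), ?_, by simp, fun y => ?_⟩
  · exact contDiff_infty.2 fun n =>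
      contDiff_parametric_intervalIntegral n 0 1 _ (contDiff_infty.1 hsm n)
  · have hcont : Continuous fun t : ℝ => fderiv ℝ f (x + t • (y - x)) :=
      hsm.continuous.comp (by fun_prop : Continuous fun t : ℝ => (y, t))
    rw [ContinuousLinearMap.intervalIntegral_apply (hcont.intervalIntegrable 0 1)]
    rw [intervalIntegral.integral_eq_sub_of_hasDerivAt (f := fun t : ℝ => f (x + t • (y - x)))]
    · simp
    · intro t _
      have h1 : HasDerivAt (fun t : ℝ => x + t • (y - x)) (y - x) t := by
        simpa using ((hasDerivAt_id t).smul_const (y - x)).const_add x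
      exact ((hf.differentiable (by simp)) (x + t • (y - x))).hasFDerivAt.comp_hasDerivAt t h1
    · exact (hcont.clm_apply continuous_const).intervalIntegrable 0 1

/-- A derivation of the algebra of smooth functions. -/
structure IsSmoothDerivation {V : Type*} [NormedAddCommGroup V] [NormedSpace ℝ V]
    (D : (V → ℝ) → V → ℝ) : Prop where
  add : ∀ f g, Cinf V f → Cinf V g → D (f + g) = D f + D g
  smul : ∀ (c : ℝ) f, Cinf V f → D (c • f) = c • D f
  mul : ∀ f g, Cinf V f → Cinf V g → D (f * g) = D f * g + f * D g

namespace Cinf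

variable {V : Type*} [NormedAddCommGroup V] [NormedSpace ℝ V]

theorem one : Cinf V 1 := contDiff_const

theorem clm (α : V →L[ℝ] ℝ) : Cinf V α := α.contDiff

theorem add {f g : V → ℝ} (hf : Cinf V f) (hg : Cinf V g) : Cinf V (f + g) := ContDiff.add hf hg

theorem mul {f g : V → ℝ} (hf : Cinf V f) (hg : Cinf V g) : Cinf V (f * g) := ContDiff.mul hf hg

theorem smul (c : ℝ) {f : V → ℝ} (hf : Cinf V f) : Cinf V (c • f) := ContDiff.const_smul c hf

end Cinf

namespace IsSmoothDerivation

variable {V : Type u} [NormedAddCommGroup V] [NormedSpace ℝ V] {D : (V → ℝ) → V → ℝ}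

theorem map_one (hD : IsSmoothDerivation D) : D 1 = 0 := by
  have h := hD.mul 1 1 Cinf.one Cinf.one
  simpa using h

theorem map_zero (hD : IsSmoothDerivation D) : D 0 = 0 := by
  simpa using hD.smul 0 1 Cinf.one

theorem map_sum (hD : IsSmoothDerivation D) {ι : Type*} (s : Finset ι) (F : ι → V → ℝ)
    (hF : ∀ i, Cinf V (F i)) : D (∑ i ∈ s, F i) = ∑ i ∈ s, D (F i) := by
  classical
  induction s using Finset.induction_on with
  | empty => simpa using hD.map_zero
  | insert i s hi ih =>
    rw [Finset.sum_insert hi, Finset.sum_insert hi, hD.add _ _ (hF i), ih]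
    have : Cinf V (fun x => ∑ i ∈ s, F i x) := ContDiff.sum fun i _ => hF i
    convert this using 1
    ext x
    simp

theorem apply_eq_zero [FiniteDimensional ℝ V] (hD : IsSmoothDerivation D) {f : V → ℝ}
    (hf : Cinf V f) {x : V} (h0 : f x = 0) (h1 : fderiv ℝ f x = 0) : D f x = 0 := by
  obtain ⟨H, hH, hHx, hfH⟩ := exists_contDiff_eq_add_apply_sub hf x
  let b := Module.finBasis ℝ V
  let p : Fin (Module.finrank ℝ V) → V → ℝ := fun i y => b.coord i (y - x)
  let h : Fin (Module.finrank ℝ V) → V → ℝ := fun i y => H y (b i)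
  have hp : ∀ i, Cinf V (p i) := fun i =>
    (LinearMap.toContinuousLinearMap (b.coord i)).contDiff.comp (contDiff_id.sub contDiff_const)
  have hh : ∀ i, Cinf V (h i) := fun i => ContDiff.clm_apply hH contDiff_const
  have hsum : f = ∑ i, p i * h i := by
    ext y
    rw [hfH y, h0, zero_add]
    conv_lhs => rw [← b.sum_repr (y - x)]
    simp [p, h]
  rw [hsum, hD.map_sum _ _ fun i => (hp i).mul (hh i), Finset.sum_apply]
  refine Finset.sum_eq_zero fun i _ => ?_
  have e1 : p i x = 0 := by simp [p]
  have e2 : h i x = 0 := by simp [h, hHx, h1]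
  simp [hD.mul _ _ (hp i) (hh i), e1, e2]

/-- A derivation of smooth functions is a first-order differential operator. -/
theorem apply_eq_fderiv [FiniteDimensional ℝ V] (hD : IsSmoothDerivation D) {f : V → ℝ}
    (hf : Cinf V f) (x : V) : D f x = D (fderiv ℝ f x) x := by
  set α := fderiv ℝ f x with hα
  have hα' : Cinf V ((-1 : ℝ) • (α : V → ℝ)) := (Cinf.clm α).smul _
  have hc : Cinf V ((α x - f x) • (1 : V → ℝ)) := Cinf.one.smul _
  have h := hD.apply_eq_zero (x := x) ((hf.add hα').add hc) (by simp; ring) (by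
    have hd : HasFDerivAt (f + (-1 : ℝ) • (α : V → ℝ) + (α x - f x) • (1 : V → ℝ))
        (α + (-1 : ℝ) • α + 0) x :=
      ((((ContDiff.differentiable hf (by simp)) x).hasFDerivAt.add
        (α.hasFDerivAt.const_smul (-1 : ℝ))).add
        (hasFDerivAt_const (α x - f x) x)).congr_of_eventuallyEq
          (Filter.Eventually.of_forall fun y => by simp)
    rw [hd.fderiv]; simp)
  rw [hD.add _ _ (hf.add hα') hc, hD.add _ _ hf hα', hD.smul _ _ (Cinf.clm α),
    hD.smul _ _ Cinf.one, hD.map_one] at h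
  simp at h
  linarith

end IsSmoothDerivation

/-- The linear and the constant part of an affine function are determined by it. -/
theorem linear_add_const_injective {V : Type*} [AddCommGroup V] [Module ℝ V] {μ ν : V →ₗ[ℝ] ℝ}
    {c d : ℝ} (h : ∀ x, μ x + c = ν x + d) : μ = ν ∧ c = d := by
  have h0 : c = d := by simpa using h 0
  exact ⟨LinearMap.ext fun x => by linarith [h x], h0⟩

theorem IsAffineFn.clm {V : Type*} [NormedAddCommGroup V] [NormedSpace ℝ V] (α : V →L[ℝ] ℝ) :
    IsAffineFn (α : V → ℝ) := ⟨α, 0, fun x => by simp⟩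

theorem IsAffineFn.one {V : Type*} [AddCommGroup V] [Module ℝ V] :
    IsAffineFn (1 : V → ℝ) := ⟨0, 1, fun x => by simp⟩

/-- An affine function whose product with every linear function is affine is constant. -/
theorem IsAffineFn.eq_const_of_mul {V : Type*} [AddCommGroup V] [Module ℝ V] {a : V → ℝ}
    (ha : IsAffineFn a) (hmul : ∀ ν : V →ₗ[ℝ] ℝ, IsAffineFn fun x => ν x * a x) (x : V) :
    a x = a 0 := by
  obtain ⟨μ, c, hμ⟩ := ha
  have key : ∀ y, μ y = 0 := by
    intro y
    obtain ⟨ν, d, h⟩ := hmul μ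
    have h0 := h 0
    have h1 := h y
    have h2 := h (-y)
    simp only [hμ, map_zero, map_neg] at h0 h1 h2
    nlinarith
  simp [hμ, key]

namespace JacobiBracket

variable {V : Type u} [NormedAddCommGroup V] [NormedSpace ℝ V] (J : JacobiBracket V (Cinf V))

theorem add_right {f g h : V → ℝ} (hf : Cinf V f) (hg : Cinf V g) (hh : Cinf V h) :
    J.br f (g + h) = J.br f g + J.br f h := by
  rw [J.antisymm _ _ hf (hg.add hh), J.add_left _ _ _ hg hh hf, J.antisymm _ _ hf hg,
    J.antisymm _ _ hf hh]
  abel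

theorem smul_right (c : ℝ) {f g : V → ℝ} (hf : Cinf V f) (hg : Cinf V g) :
    J.br f (c • g) = c • J.br f g := by
  rw [J.antisymm _ _ hf (hg.smul c), J.smul_left _ _ _ hg hf, J.antisymm _ _ hf hg, smul_neg]

theorem br_self {f : V → ℝ} (hf : Cinf V f) : J.br f f = 0 :=
  self_eq_neg.1 (J.antisymm f f hf hf)

/-- The hamiltonian operator of a smooth function is a derivation. -/
theorem isSmoothDerivation_hamiltonian {f : V → ℝ} (hf : Cinf V f) :
    IsSmoothDerivation fun g => J.br f g + g * J.br 1 f where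
  add g h hg hh := by
    simp only [J.add_right hf hg hh]
    ring
  smul c g hg := by
    simp only [J.smul_right c hf hg, smul_add, smul_mul_assoc]
  mul g h hg hh := by
    simp only [J.leibniz f g h hf hg hh, J.antisymm f 1 hf Cinf.one]
    ring

theorem isSmoothDerivation_br_one : IsSmoothDerivation (J.br 1) := by
  simpa [J.br_self Cinf.one] using J.isSmoothDerivation_hamiltonian Cinf.one

/-- A Jacobi bracket at a point is determined by the brackets of the differentials. -/
theorem br_apply_eq [FiniteDimensional ℝ V] {f g : V → ℝ} (hf : Cinf V f) (hg : Cinf V g) (x : V) :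
    J.br f g x = J.br (fderiv ℝ f x) (fderiv ℝ g x) x
      + (f x - fderiv ℝ f x x) * J.br 1 (fderiv ℝ g x) x
      - (g x - fderiv ℝ g x x) * J.br 1 (fderiv ℝ f x) x := by
  have e1 := (J.isSmoothDerivation_hamiltonian hf).apply_eq_fderiv hg x
  have e2 := (J.isSmoothDerivation_hamiltonian (Cinf.clm (fderiv ℝ g x))).apply_eq_fderiv hf x
  have e3 := J.isSmoothDerivation_br_one.apply_eq_fderiv hf x
  have a1 := congrFun (J.antisymm _ _ hf (Cinf.clm (fderiv ℝ g x))) x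
  have a2 := congrFun (J.antisymm _ _ (Cinf.clm (fderiv ℝ f x)) (Cinf.clm (fderiv ℝ g x))) x
  simp only [Pi.add_apply, Pi.mul_apply, Pi.neg_apply] at e1 e2 a1 a2
  rw [e3] at e1
  linarith

/-- For a strongly affine bracket, `{1, ·}` acts on linear functions as evaluation at a vector. -/
theorem exists_br_one_eq [FiniteDimensional ℝ V] (hJ : IsAffineJacobi J)
    (hstrong : ∀ a b, Cinf V a → Cinf V b → IsAffineFn a → IsAffineFn b →
      IsAffineFn (fun x => J.br a b x + b x * J.br 1 a x)) :
    ∃ X₀ : V, ∀ (α : V →L[ℝ] ℝ) (x : V), J.br 1 α x = -α X₀ := by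
  let φ : Module.Dual ℝ (Module.Dual ℝ V) :=
    { toFun := fun α => -J.br 1 (LinearMap.toContinuousLinearMap α) 0
      map_add' := fun α β => by
        have h := congrFun (J.add_right Cinf.one (Cinf.clm (LinearMap.toContinuousLinearMap α))
          (Cinf.clm (LinearMap.toContinuousLinearMap β))) 0
        simp only [Pi.add_apply] at h
        rw [← neg_add, ← h]
        rfl
      map_smul' := fun c α => by
        have h := congrFun (J.smul_right c Cinf.one
          (Cinf.clm (LinearMap.toContinuousLinearMap α))) 0
        simp only [Pi.smul_apply] at h
        rw [RingHom.id_apply, smul_neg, ← h]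
        rfl }
  refine ⟨(Module.evalEquiv ℝ V).symm φ, fun α x => ?_⟩
  have hconst : J.br 1 α x = J.br 1 α 0 := by
    refine (hJ 1 α Cinf.one (Cinf.clm α) IsAffineFn.one (IsAffineFn.clm α)).eq_const_of_mul
      (fun ν => ?_) x
    obtain ⟨μ, c, h⟩ := hstrong α (LinearMap.toContinuousLinearMap ν) (Cinf.clm α) (Cinf.clm _)
      (IsAffineFn.clm α) (IsAffineFn.clm _)
    obtain ⟨μ', c', h'⟩ := hJ α (LinearMap.toContinuousLinearMap ν) (Cinf.clm α) (Cinf.clm _)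
      (IsAffineFn.clm α) (IsAffineFn.clm _)
    refine ⟨μ - μ', c - c', fun y => ?_⟩
    have h1 := h y
    have h2 := h' y
    simp only [LinearMap.coe_toContinuousLinearMap', LinearMap.sub_apply] at h1 h2 ⊢
    linarith
  have := Module.apply_evalEquiv_symm_apply (R := ℝ) (M := V) (α : V →ₗ[ℝ] ℝ) φ
  rw [hconst]
  change α ((Module.evalEquiv ℝ V).symm φ) = -J.br 1 α 0 at this
  rw [this, neg_neg]

end JacobiBracket

/-- The decomposition of the bracket of linear functions into linear and constant part gives
Jacobi algebroid data. -/
theorem jacobiAlgebroidData_of_br_eq {V : Type u} [NormedAddCommGroup V] [NormedSpace ℝ V]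
    (J : JacobiBracket V (Cinf V)) {B : (V →L[ℝ] ℝ) → (V →L[ℝ] ℝ) → (V →L[ℝ] ℝ)} {X₀ : V}
    {P₀ : (V →L[ℝ] ℝ) → (V →L[ℝ] ℝ) → ℝ} (hX : ∀ (α : V →L[ℝ] ℝ) x, J.br 1 α x = -α X₀)
    (hB : ∀ (α β : V →L[ℝ] ℝ) x, J.br α β x = B α β x - P₀ α β) :
    JacobiAlgebroidData V B X₀ P₀ := by
  have split : ∀ (μ ν : V →L[ℝ] ℝ) (c d : ℝ), (∀ x, μ x + c = ν x + d) → μ = ν ∧ c = d := by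
    intro μ ν c d h
    have := linear_add_const_injective (μ := (μ : V →ₗ[ℝ] ℝ)) (ν := ν) h
    exact ⟨ContinuousLinearMap.coe_injective this.1, this.2⟩
  have hadd : ∀ α β γ, B (α + β) γ = B α γ + B β γ ∧
      -P₀ (α + β) γ = -(P₀ α γ + P₀ β γ) := by
    refine fun α β γ => split _ _ _ _ fun x => ?_
    have h := congrFun (J.add_left α β γ (Cinf.clm α) (Cinf.clm β) (Cinf.clm γ)) x
    rw [← FunLike.coe_add] at h
    simp only [Pi.add_apply, hB] at h
    simp only [add_apply]
    linarith
  have hsmul : ∀ (r : ℝ) α β, B (r • α) β = r • B α β ∧ -P₀ (r • α) β = -(r * P₀ α β) := by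
    refine fun r α β => split _ _ _ _ fun x => ?_
    have h := congrFun (J.smul_left r α β (Cinf.clm α) (Cinf.clm β)) x
    rw [← FunLike.coe_smul] at h
    simp only [Pi.smul_apply, hB, smul_eq_mul] at h
    simp only [smul_apply, smul_eq_mul]
    linarith
  have hneg : ∀ α β, B α β = -B β α ∧ -P₀ α β = P₀ β α := by
    refine fun α β => split _ _ _ _ fun x => ?_
    have h := congrFun (J.antisymm α β (Cinf.clm α) (Cinf.clm β)) x
    simp only [Pi.neg_apply, hB] at h
    simp only [neg_apply]
    linarith
  have hBfun : ∀ α β : V →L[ℝ] ℝ, J.br α β = (B α β : V → ℝ) + (-P₀ α β) • (1 : V → ℝ) := by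
    intro α β
    ext x
    simp [hB, sub_eq_add_neg]
  have hXfun : ∀ α : V →L[ℝ] ℝ, J.br 1 α = (-α X₀) • (1 : V → ℝ) := by
    intro α
    ext x
    simp [hX]
  have hnest : ∀ (α β γ : V →L[ℝ] ℝ) x,
      J.br α (J.br β γ) x = B α (B β γ) x - P₀ α (B β γ) - P₀ β γ * α X₀ := by
    intro α β γ x
    rw [hBfun β γ, J.add_right (Cinf.clm α) (Cinf.clm _) (Cinf.one.smul _),
      J.smul_right _ (Cinf.clm α) Cinf.one, J.antisymm α 1 (Cinf.clm α) Cinf.one]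
    simp only [Pi.add_apply, Pi.smul_apply, Pi.neg_apply, hB, hX, smul_eq_mul]
    ring
  have hjac : ∀ α β γ, B α (B β γ) + B β (B γ α) + B γ (B α β) = 0 ∧
      -(P₀ α (B β γ) + P₀ β (B γ α) + P₀ γ (B α β))
        = P₀ β γ * α X₀ + P₀ γ α * β X₀ + P₀ α β * γ X₀ := by
    refine fun α β γ => split _ _ _ _ fun x => ?_
    have h := congrFun (J.jacobi α β γ (Cinf.clm α) (Cinf.clm β) (Cinf.clm γ)) x
    simp only [Pi.add_apply, Pi.zero_apply, hnest] at h
    simp only [add_apply, zero_apply]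
    linarith
  refine ⟨fun α β γ => (hadd α β γ).1, fun r α β => (hsmul r α β).1, fun α β => (hneg α β).1,
    fun α β γ => (hjac α β γ).1, fun α β => ?_, fun α β γ => neg_injective (hadd α β γ).2,
    fun r α β => neg_injective (hsmul r α β).2, fun α β => ?_, fun α β γ => ?_⟩
  · have h := congrFun (J.jacobi 1 α β Cinf.one (Cinf.clm α) (Cinf.clm β)) 0
    rw [J.antisymm β 1 (Cinf.clm β) Cinf.one, hXfun, hXfun, hBfun α β,
      J.add_right Cinf.one (Cinf.clm _) (Cinf.one.smul _),
      J.smul_right _ Cinf.one Cinf.one, ← neg_smul, J.smul_right _ (Cinf.clm α) Cinf.one,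
      J.smul_right _ (Cinf.clm β) Cinf.one, J.antisymm α 1 (Cinf.clm α) Cinf.one,
      J.antisymm β 1 (Cinf.clm β) Cinf.one, J.br_self Cinf.one] at h
    simp only [Pi.add_apply, Pi.smul_apply, Pi.neg_apply, Pi.zero_apply, hX, smul_eq_mul] at h
    linarith
  · linarith [(hneg α β).2]
  · linarith [(hjac α β γ).2, (hneg (B α β) γ).2, (hneg (B β γ) α).2, (hneg (B γ α) β).2]

/-- every strongly-affine Jacobi bracket on `C^∞(𝔤,ℝ)`, `𝔤` a
finite-dimensional real vector space of positive dimension, is given by a unique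
triple `([·,·]_*, X₀, P₀)` as in the formula
`{f,g}(x) = [Df(x),Dg(x)]_*(x) + Df(x)(x)·Dg(x)(X₀) − Df(x)(X₀)·Dg(x)(x)
 − P₀(Df(x),Dg(x)) − f(x)·Dg(x)(X₀) + g(x)·Df(x)(X₀)`. -/
theorem stmt14 (g : Type*) [NormedAddCommGroup g] [NormedSpace ℝ g]
    [FiniteDimensional ℝ g] (hg : 0 < Module.finrank ℝ g)
    (J : JacobiBracket g (Cinf g)) (hJ : IsAffineJacobi J)
    (hstrong : ∀ a b, Cinf g a → Cinf g b → IsAffineFn a → IsAffineFn b →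
      IsAffineFn (fun x => J.br a b x + b x * J.br 1 a x)) :
    ∃ (B : (g →L[ℝ] ℝ) → (g →L[ℝ] ℝ) → (g →L[ℝ] ℝ)) (X₀ : g)
      (P₀ : (g →L[ℝ] ℝ) → (g →L[ℝ] ℝ) → ℝ),
      JacobiAlgebroidData g B X₀ P₀ ∧ BrFormula g J B X₀ P₀ ∧
      -- uniqueness of the triple
      (∀ (B' : (g →L[ℝ] ℝ) → (g →L[ℝ] ℝ) → (g →L[ℝ] ℝ)) (X₀' : g)
          (P₀' : (g →L[ℝ] ℝ) → (g →L[ℝ] ℝ) → ℝ),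
        JacobiAlgebroidData g B' X₀' P₀' → BrFormula g J B' X₀' P₀' →
        (∀ α β, B' α β = B α β) ∧ X₀' = X₀ ∧ (∀ α β, P₀' α β = P₀ α β)) := by
  obtain ⟨X₀, hX⟩ := J.exists_br_one_eq hJ hstrong
  have haff : ∀ α β : g →L[ℝ] ℝ, ∃ (μ : g →ₗ[ℝ] ℝ) (c : ℝ), ∀ x, J.br α β x = μ x + c :=
    fun α β => hJ α β (Cinf.clm α) (Cinf.clm β) (IsAffineFn.clm α) (IsAffineFn.clm β)
  choose μ c hμ using haff
  let B : (g →L[ℝ] ℝ) → (g →L[ℝ] ℝ) → (g →L[ℝ] ℝ) :=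
    fun α β => LinearMap.toContinuousLinearMap (μ α β)
  have hB : ∀ (α β : g →L[ℝ] ℝ) x, J.br α β x = B α β x - -c α β := by
    intro α β x
    simp [B, hμ]
  refine ⟨B, X₀, fun α β => -c α β, jacobiAlgebroidData_of_br_eq J hX hB, ?_, ?_⟩
  · intro f h hf hh x
    rw [J.br_apply_eq hf hh x, hB, hX, hX]
    ring
  · intro B' X₀' P₀' hdata hbr
    have hX' : ∀ α : g →L[ℝ] ℝ, α X₀' = α X₀ := by
      intro α
      have hB0 : B' 0 α = 0 := by simpa using hdata.2.1 0 0 α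
      have hP0 : P₀' 0 α = 0 := by simpa using hdata.2.2.2.2.2.2.1 0 0 α
      have hone : fderiv ℝ (1 : g → ℝ) 0 = 0 := (hasFDerivAt_const (1 : ℝ) (0 : g)).fderiv
      have h := hbr 1 α Cinf.one (Cinf.clm α) 0
      rw [hX, hone, α.fderiv, hB0, hP0] at h
      simp at h
      linarith
    have hX₀ : X₀' = X₀ := by
      by_contra hne
      obtain ⟨α, hα⟩ := SeparatingDual.exists_separating_of_ne (R := ℝ) hne
      exact hα (hX' α)
    have hlin : ∀ (α β : g →L[ℝ] ℝ) x, μ α β x + c α β = B' α β x + -P₀' α β := by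
      intro α β x
      have h := hbr α β (Cinf.clm α) (Cinf.clm β) x
      rw [hμ, α.fderiv, β.fderiv] at h
      linarith
    refine ⟨fun α β => ?_, hX₀, fun α β => ?_⟩
    · ext x
      have h := (linear_add_const_injective (ν := (B' α β : g →ₗ[ℝ] ℝ)) (hlin α β)).1
      simp [B, h]
    · have h := (linear_add_const_injective (ν := (B' α β : g →ₗ[ℝ] ℝ)) (hlin α β)).2
      linarith
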